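/- Let i : (g_D, g_{D,−}, g_{D,+}) → (g, g₋, g₊) be a split embedding of finite-dimensional Manin triples over a field k of characteristic zero, and let p_± : g_± → g_{D,±} be the linear maps determined by ⟨p_±(x), y⟩_D = ⟨x, i(y)⟩ for all x ∈ g_±, y ∈ g_{D,∓}. Then p₊ and p₋ are Lie algebra homomorphisms: p_±([X₁, X₂]) = [p_±(X₁), p_±(X₂)] for all X₁, X₂ ∈ g_±. -/

import Mathlib

namespace ManinStmt

/-- A (finite-dimensional) Manin triple: a Lie algebra `g` with a nondegenerate
symmetric invariant bilinear form and two isotropic Lie subalgebras `plus`,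
`minus` with `g = minus ⊕ plus` as vector spaces. -/
structure ManinTriple (k g : Type*) [Field k] [LieRing g] [LieAlgebra k g] where
  form : g →ₗ[k] g →ₗ[k] k
  nondeg : ∀ x : g, (∀ y : g, form x y = 0) → x = 0
  symm : ∀ x y : g, form x y = form y x
  invariant : ∀ x y z : g, form ⁅x, y⁆ z = form x ⁅y, z⁆
  plus : LieSubalgebra k g
  minus : LieSubalgebra k g
  isotropic_plus : ∀ x ∈ plus, ∀ y ∈ plus, form x y = 0
  isotropic_minus : ∀ x ∈ minus, ∀ y ∈ minus, form x y = 0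
  compl : IsCompl minus.toSubmodule plus.toSubmodule

variable {k gD g : Type*} [Field k]
  [LieRing gD] [LieAlgebra k gD] [LieRing g] [LieAlgebra k g]

/-- An embedding of Manin triples: an injective, form-preserving Lie algebra
morphism mapping `plus` into `plus` and `minus` into `minus`. -/
structure IsManinEmbedding (TD : ManinTriple k gD) (T : ManinTriple k g)
    (i : gD →ₗ⁅k⁆ g) : Prop where
  inj : Function.Injective i
  form_eq : ∀ x y : gD, T.form (i x) (i y) = TD.form x y
  maps_plus : ∀ x ∈ TD.plus, i x ∈ T.plus
  maps_minus : ∀ x ∈ TD.minus, i x ∈ T.minus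

/-- The orthogonal complement of `i(gD)` in `g` with respect to the form of `T`. -/
def perpD (T : ManinTriple k g) (i : gD →ₗ⁅k⁆ g) : Submodule k g where
  carrier := {x | ∀ d : gD, T.form x (i d) = 0}
  add_mem' := fun {a b} ha hb d => by
    rw [map_add, LinearMap.add_apply, ha d, hb d, add_zero]
  zero_mem' := fun d => by simp
  smul_mem' := fun c x hx d => by
    rw [map_smul, LinearMap.smul_apply, hx d, smul_zero]

/-- `m₊ = g₊ ∩ i(gD)^⊥`. -/
def mPlus (T : ManinTriple k g) (i : gD →ₗ⁅k⁆ g) : Submodule k g :=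
  T.plus.toSubmodule ⊓ perpD T i

/-- `m₋ = g₋ ∩ i(gD)^⊥`. -/
def mMinus (T : ManinTriple k g) (i : gD →ₗ⁅k⁆ g) : Submodule k g :=
  T.minus.toSubmodule ⊓ perpD T i

/-- The embedding is split if `m₊` and `m₋` are Lie subalgebras of `g`. -/
def IsSplit (T : ManinTriple k g) (i : gD →ₗ⁅k⁆ g) : Prop :=
  (∀ x ∈ mPlus T i, ∀ y ∈ mPlus T i, ⁅x, y⁆ ∈ mPlus T i) ∧
  (∀ x ∈ mMinus T i, ∀ y ∈ mMinus T i, ⁅x, y⁆ ∈ mMinus T i)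


/-- The orthogonal complement of `i(gD)` is stable under the adjoint action of `i(gD)`. -/
theorem lie_mem_perpD (T : ManinTriple k g) (i : gD →ₗ⁅k⁆ g) {m : g} (hm : m ∈ perpD T i)
    (a : gD) : ⁅m, i a⁆ ∈ perpD T i := fun d => by
  rw [T.invariant, ← LieHom.map_lie]
  exact hm _

/-- An element orthogonal to two submodules spanning a Manin triple is zero. -/
theorem eq_zero_of_orthogonal (T : ManinTriple k g) {P N : Submodule k g} (hPN : N ⊔ P = ⊤)
    {x : g} (hP : ∀ y ∈ P, T.form x y = 0) (hN : ∀ y ∈ N, T.form x y = 0) : x = 0 := by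
  refine T.nondeg x fun y => ?_
  obtain ⟨u, hu, v, hv, rfl⟩ := Submodule.mem_sup.1 (hPN ▸ Submodule.mem_top : y ∈ N ⊔ P)
  rw [map_add, hN u hu, hP v hv, add_zero]

/-- If `P` is an isotropic subalgebra containing the image of an isotropic subalgebra `PD`, and
`P ∩ i(gD)^⊥` is closed under the bracket, then the projection `P → PD` adjoint to `i` preserves
brackets. -/
theorem projection_lie (TD : ManinTriple k gD) (T : ManinTriple k g) (i : gD →ₗ⁅k⁆ g)
    (hform : ∀ x y : gD, T.form (i x) (i y) = TD.form x y)
    (P : LieSubalgebra k g) (PD ND : LieSubalgebra k gD)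
    (hspan : ND.toSubmodule ⊔ PD.toSubmodule = ⊤)
    (hP : ∀ x ∈ P, ∀ y ∈ P, T.form x y = 0)
    (hPD : ∀ x ∈ PD, ∀ y ∈ PD, TD.form x y = 0)
    (hmaps : ∀ x ∈ PD, i x ∈ P)
    (hm : ∀ x ∈ P.toSubmodule ⊓ perpD T i, ∀ y ∈ P.toSubmodule ⊓ perpD T i,
      ⁅x, y⁆ ∈ P.toSubmodule ⊓ perpD T i)
    (p : P →ₗ[k] PD)
    (hp : ∀ (x : P) (y : ND), TD.form ↑(p x) ↑y = T.form ↑x (i ↑y))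
    (X₁ X₂ : P) : p ⁅X₁, X₂⁆ = ⁅p X₁, p X₂⁆ := by
  have hdiff (X : P) : (X : g) - i (p X) ∈ P.toSubmodule ⊓ perpD T i := by
    refine ⟨P.toSubmodule.sub_mem X.2 (hmaps _ (p X).2), fun d => ?_⟩
    obtain ⟨u, hu, v, hv, rfl⟩ := Submodule.mem_sup.1
      (hspan ▸ Submodule.mem_top : d ∈ ND.toSubmodule ⊔ PD.toSubmodule)
    have h₁ := hp X ⟨u, hu⟩
    have h₂ := hP X X.2 (i v) (hmaps v hv)
    have h₃ := hPD (p X) (p X).2 v hv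
    simp only [map_sub, map_add, LinearMap.sub_apply, hform, h₂, h₃] at h₁ ⊢
    rw [h₁]
    ring
  have hbracket : ⁅(X₁ : g), (X₂ : g)⁆ - i ⁅(p X₁ : gD), (p X₂ : gD)⁆ ∈ perpD T i := by
    have h₁ := lie_mem_perpD T i (hdiff X₁).2 (p X₂)
    have h₂ := lie_mem_perpD T i (hdiff X₂).2 (p X₁)
    have h₃ := (hm _ (hdiff X₁) _ (hdiff X₂)).2
    convert (perpD T i).sub_mem ((perpD T i).add_mem h₃ h₁) h₂ using 1
    rw [LieHom.map_lie, ← lie_skew ((X₂ : g) - i (p X₂)) (i (p X₁))]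
    simp only [lie_sub, sub_lie]
    abel
  apply Subtype.ext
  rw [← sub_eq_zero]
  refine eq_zero_of_orthogonal TD hspan
    (hPD _ (PD.toSubmodule.sub_mem (p ⁅X₁, X₂⁆).2 (⁅p X₁, p X₂⁆ : PD).2)) fun y hy => ?_
  have h := hbracket y
  have h' := hp ⁅X₁, X₂⁆ ⟨y, hy⟩
  simp only [map_sub, LinearMap.sub_apply, hform, LieSubalgebra.coe_bracket] at h h' ⊢
  rw [h', h]

/-- for a split embedding of Manin triples, the projections
`p_± : g_± → g_{D,±}` determined by `⟨p_±(x), y⟩_D = ⟨x, i(y)⟩` are Lie algebra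
homomorphisms. -/
theorem projections_are_lie_homs [CharZero k]
    [FiniteDimensional k gD] [FiniteDimensional k g]
    (TD : ManinTriple k gD) (T : ManinTriple k g)
    (i : gD →ₗ⁅k⁆ g) (hi : IsManinEmbedding TD T i) (hsplit : IsSplit T i) :
    (∀ p : ↥T.plus →ₗ[k] ↥TD.plus,
        (∀ (x : ↥T.plus) (y : ↥TD.minus),
          TD.form ↑(p x) ↑y = T.form ↑x (i ↑y)) →
        ∀ X₁ X₂ : ↥T.plus, p ⁅X₁, X₂⁆ = ⁅p X₁, p X₂⁆) ∧
    (∀ p : ↥T.minus →ₗ[k] ↥TD.minus,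
        (∀ (x : ↥T.minus) (y : ↥TD.plus),
          TD.form ↑(p x) ↑y = T.form ↑x (i ↑y)) →
        ∀ X₁ X₂ : ↥T.minus, p ⁅X₁, X₂⁆ = ⁅p X₁, p X₂⁆) := by
  exact ⟨projection_lie TD T i hi.form_eq T.plus TD.plus TD.minus TD.compl.sup_eq_top
      T.isotropic_plus TD.isotropic_plus hi.maps_plus hsplit.1,
    projection_lie TD T i hi.form_eq T.minus TD.minus TD.plus TD.compl.symm.sup_eq_top
      T.isotropic_minus TD.isotropic_minus hi.maps_minus hsplit.2⟩

end ManinStmt
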